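/- Let 0 < t ≤ 1, let Ω be a t-quasidisk, and let f be a conformal map of 𝔻 onto Ω with induced boundary values f : 𝕋 → ∂Ω. Then there exists a constant M > 0 (depending on f) such that for all a, b, x ∈ 𝕋 with |a−x| = |b−x|: |f(a) − f(x)|^(1/t) ≤ M·|f(b) − f(x)|^t. (For t = 1 this is Ahlfors' M-condition for quasisymmetry.) -/

import Mathlib

open Metric Set Real

/-- A parametrization of a Jordan curve: a continuous `2π`-periodic map which is
injective on a period. -/
def IsJordanParam (p : ℝ → ℂ) : Prop :=
  Continuous p ∧ Function.Periodic p (2 * π) ∧ Set.InjOn p (Set.Ico 0 (2 * π))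

/-- A set `Γ ⊆ ℂ` is a Jordan curve if it is the range of some Jordan parametrization. -/
def IsJordanCurve (Γ : Set ℂ) : Prop :=
  ∃ p : ℝ → ℂ, IsJordanParam p ∧ Set.range p = Γ

/-- `A` is a subarc of the Jordan curve `Γ` joining `x` and `y`. -/
def IsSubarc (Γ : Set ℂ) (x y : ℂ) (A : Set ℂ) : Prop :=
  ∃ p : ℝ → ℂ, IsJordanParam p ∧ Set.range p = Γ ∧
    ∃ a b : ℝ, a ≤ b ∧ b ≤ a + 2 * π ∧ p a = x ∧ p b = y ∧ A = p '' Set.Icc a b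

/-- `Γ` satisfies the `t`-quasicircle condition with constant `C`. -/
def TQuasicircleCond (t C : ℝ) (Γ : Set ℂ) : Prop :=
  ∀ x ∈ Γ, ∀ y ∈ Γ, ∃ A : Set ℂ, IsSubarc Γ x y A ∧ Metric.diam A ≤ C * dist x y ^ t

/-- `Ω` is a `t`-quasidisk with boundary `Γ`: the bounded connected component of the
complement of a `t`-quasicircle `Γ`. -/
def IsTQuasidisk (t : ℝ) (Γ Ω : Set ℂ) : Prop :=
  IsJordanCurve Γ ∧ (∃ C : ℝ, 1 ≤ C ∧ TQuasicircleCond t C Γ) ∧ Bornology.IsBounded Ω ∧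
    ∃ x ∈ Γᶜ, Ω = connectedComponentIn Γᶜ x


open MeasureTheory Filter Topology

/-- The square of a conformal density on the plane concentrated on the annulus
`r ≤ ‖w‖ ≤ R`, where it is comparable to `1 / ‖w‖ ^ 2`. -/
noncomputable def annulusDensitySq (r R : ℝ) (w : ℂ) : ℝ :=
  4 * R ^ 2 / ((‖w‖ ^ 2 + r ^ 2) * (‖w‖ ^ 2 + R ^ 2))

/-- A smooth radial function whose gradient is dominated by the square root of
`annulusDensitySq`. -/
noncomputable def annulusPotential (r R : ℝ) (w : ℂ) : ℝ :=
  log (‖w‖ ^ 2 + r ^ 2) - log (‖w‖ ^ 2 + R ^ 2)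

lemma annulusDensitySq_nonneg (r R : ℝ) (w : ℂ) : 0 ≤ annulusDensitySq r R w := by
  unfold annulusDensitySq; positivity

lemma continuous_annulusDensitySq {r R : ℝ} (hr : 0 < r) (hR : 0 < R) :
    Continuous (annulusDensitySq r R) := by
  unfold annulusDensitySq
  refine Continuous.div (by fun_prop) (by fun_prop) fun w => by positivity

lemma continuous_annulusPotential {r R : ℝ} (hr : 0 < r) (hR : 0 < R) :
    Continuous (annulusPotential r R) := by
  unfold annulusPotential
  refine Continuous.sub (Continuous.log (by fun_prop) fun w => ?_)
    (Continuous.log (by fun_prop) fun w => ?_) <;> positivity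

lemma lintegral_annulusDensitySq_le {r R : ℝ} (hr : 0 < r) (hR : 2 * r ≤ R) :
    ∫⁻ w : ℂ, ENNReal.ofReal (annulusDensitySq r R w) ≤
      ENNReal.ofReal (32 * π / 3 * log (R / r)) := by
  have hR0 : 0 < R := by linarith
  have hL : 0 ≤ log (R / r) := log_nonneg (by rw [le_div_iff₀ hr]; linarith)
  have hd : 0 < R ^ 2 - r ^ 2 := by nlinarith
  set g : ℝ → ℝ := fun x =>
    2 * R ^ 2 / (R ^ 2 - r ^ 2) * log ((x ^ 2 + r ^ 2) / (x ^ 2 + R ^ 2)) with hg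
  set g' : ℝ → ℝ := fun x => x * (4 * R ^ 2 / ((x ^ 2 + r ^ 2) * (x ^ 2 + R ^ 2))) with hg'
  have hder : ∀ x ∈ Ici (0 : ℝ), HasDerivAt g (g' x) x := by
    intro x hx
    have h1 : HasDerivAt (fun y : ℝ => y ^ 2 + r ^ 2) (2 * x) x := by
      simpa using (hasDerivAt_pow 2 x).add_const (r ^ 2)
    have h2 : HasDerivAt (fun y : ℝ => y ^ 2 + R ^ 2) (2 * x) x := by
      simpa using (hasDerivAt_pow 2 x).add_const (R ^ 2)
    have p1 : 0 < x ^ 2 + r ^ 2 := by positivity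
    have p2 : 0 < x ^ 2 + R ^ 2 := by positivity
    have h3 := ((h1.div h2 p2.ne').log (div_pos p1 p2).ne').const_mul
      (2 * R ^ 2 / (R ^ 2 - r ^ 2))
    refine h3.congr_deriv ?_
    simp only [hg', Pi.div_apply]
    field_simp
    ring
  have hpos : ∀ x ∈ Ioi (0 : ℝ), 0 ≤ g' x := by
    intro x hx
    have : 0 < x := hx
    simp only [hg']; positivity
  have hlim : Tendsto g atTop (𝓝 0) := by
    have h1 : Tendsto (fun x : ℝ => (x ^ 2 + r ^ 2) / (x ^ 2 + R ^ 2)) atTop (𝓝 1) := by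
      have h2 : Tendsto (fun x : ℝ => 1 - (R ^ 2 - r ^ 2) / (x ^ 2 + R ^ 2)) atTop (𝓝 (1 - 0)) :=
        tendsto_const_nhds.sub (tendsto_const_nhds.div_atTop
          (tendsto_atTop_add_const_right _ _ (tendsto_pow_atTop two_ne_zero)))
      rw [sub_zero] at h2
      refine h2.congr fun x => ?_
      have : 0 < x ^ 2 + R ^ 2 := by positivity
      field_simp
      ring
    have h3 := (h1.log one_ne_zero).const_mul (2 * R ^ 2 / (R ^ 2 - r ^ 2))
    simpa [hg] using h3
  have hint := integral_Ioi_of_hasDerivAt_of_nonneg' hder hpos hlim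
  have hintg := integrableOn_Ioi_deriv_of_nonneg' hder hpos hlim
  have hg0 : 0 - g 0 = 4 * R ^ 2 / (R ^ 2 - r ^ 2) * log (R / r) := by
    have : log ((0 ^ 2 + r ^ 2) / (0 ^ 2 + R ^ 2)) = - (2 * log (R / r)) := by
      rw [← log_rpow (by positivity), ← log_inv]
      congr 1
      rw [show (2 : ℝ) = (2 : ℕ) by norm_num, rpow_natCast]
      field_simp
      simp
    simp only [hg, this]; ring
  rw [← Complex.lintegral_comp_polarCoord_symm]
  have hcongr : ∫⁻ p in polarCoord.target,
      ENNReal.ofReal p.1 • ENNReal.ofReal (annulusDensitySq r R (Complex.polarCoord.symm p)) =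
      ∫⁻ p in Ioi (0 : ℝ) ×ˢ Ioo (-π) π, ENNReal.ofReal (g' p.1) := by
    rw [polarCoord_target]
    refine setLIntegral_congr_fun (measurableSet_Ioi.prod measurableSet_Ioo) fun p hp => ?_
    have hp1 : 0 < p.1 := hp.1
    simp only [smul_eq_mul]
    rw [← ENNReal.ofReal_mul hp1.le]
    simp [annulusDensitySq, hg']
  rw [hcongr, Measure.volume_eq_prod, ← Measure.prod_restrict]
  refine (lintegral_prod_le _).trans ?_
  simp only [lintegral_const, Measure.restrict_apply_univ, Real.volume_Ioo]
  rw [lintegral_mul_const' _ _ ENNReal.ofReal_ne_top,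
    ← ofReal_integral_eq_lintegral_ofReal hintg
      ((ae_restrict_iff' measurableSet_Ioi).2 (Eventually.of_forall hpos)), hint, hg0,
    ← ENNReal.ofReal_mul (by positivity)]
  apply ENNReal.ofReal_le_ofReal
  have : 4 * R ^ 2 / (R ^ 2 - r ^ 2) ≤ 16 / 3 := by
    rw [div_le_div_iff₀ hd (by norm_num)]; nlinarith
  calc _ ≤ 16 / 3 * log (R / r) * (π - -π) := by gcongr; linarith [pi_pos]
    _ = _ := by ring

lemma abs_det_smul_restrictScalars (c : ℂ) :
    |((ContinuousLinearMap.toSpanSingleton ℂ c).restrictScalars ℝ).det| = ‖c‖ ^ 2 := by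
  have h : (((ContinuousLinearMap.toSpanSingleton ℂ c).restrictScalars ℝ : ℂ →L[ℝ] ℂ) : ℂ →ₗ[ℝ] ℂ)
      = Algebra.lmul ℝ ℂ c := by
    ext; simp [mul_comm]
  rw [ContinuousLinearMap.det, h, ← Algebra.norm_apply, Algebra.norm_complex_apply,
    Complex.normSq_eq_norm_sq, abs_of_nonneg (by positivity)]

lemma lintegral_normSq_deriv_mul_comp_le {F : ℂ → ℂ} {U : Set ℂ} (hU : IsOpen U)
    (hF : DifferentiableOn ℂ F U) (hinj : InjOn F U) (g : ℂ → ENNReal) :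
    ∫⁻ z in U, ENNReal.ofReal (‖deriv F z‖ ^ 2) * g (F z) ≤ ∫⁻ w, g w := by
  have := lintegral_image_eq_lintegral_abs_det_fderiv_mul volume hU.measurableSet
    (f := F)
    (f' := fun z => (ContinuousLinearMap.toSpanSingleton ℂ (deriv F z)).restrictScalars ℝ)
    (fun z hz => ((hF.differentiableAt (hU.mem_nhds hz)).hasDerivAt.hasFDerivAt.restrictScalars
      ℝ).hasFDerivWithinAt) hinj g
  simp only [abs_det_smul_restrictScalars] at this
  rw [← this]
  exact setLIntegral_le_lintegral _ _

/-- The upper half of the open annulus of radii `s` and `3 * s` about the origin. -/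
def halfAnnulus (s : ℝ) : Set ℂ := {z | s < ‖z‖ ∧ ‖z‖ < 3 * s ∧ 0 < z.im}

lemma isOpen_halfAnnulus (s : ℝ) : IsOpen (halfAnnulus s) :=
  (isOpen_lt continuous_const continuous_norm).inter
    ((isOpen_lt continuous_norm continuous_const).inter
      (isOpen_lt continuous_const Complex.continuous_im))

lemma mul_exp_mem_halfAnnulus {s x y : ℝ} (hs : 0 < s) (hx : x ∈ Ioo s (3 * s))
    (hy : y ∈ Ioo 0 π) : (x * Complex.exp (y * Complex.I) : ℂ) ∈ halfAnnulus s := by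
  have hx0 : 0 < x := hs.trans hx.1
  have hn : ‖(x * Complex.exp (y * Complex.I) : ℂ)‖ = x := by
    rw [norm_mul, Complex.norm_exp_ofReal_mul_I, mul_one, Complex.norm_real,
      Real.norm_of_nonneg hx0.le]
  refine ⟨hn.symm ▸ hx.1, hn.symm ▸ hx.2, ?_⟩
  rw [Complex.im_ofReal_mul, Complex.exp_ofReal_mul_I_im]
  exact mul_pos hx0 (sin_pos_of_mem_Ioo hy)

lemma lintegral_polar_halfAnnulus_le {s : ℝ} (hs : 0 < s) {G : ℂ → ℝ}
    (hG : ContinuousOn G (halfAnnulus s)) :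
    ∫⁻ x in Ioo s (3 * s), ∫⁻ y in Ioo 0 π,
        ENNReal.ofReal (x * G (x * Complex.exp (y * Complex.I))) ≤
      ∫⁻ z in halfAnnulus s, ENNReal.ofReal (G z) := by
  set P : ℝ × ℝ → ℂ := fun p => p.1 * Complex.exp (p.2 * Complex.I) with hP
  have hPc : Continuous P := by fun_prop
  have hmeas : AEMeasurable (fun p : ℝ × ℝ => ENNReal.ofReal (p.1 * G (P p)))
      ((volume.restrict (Ioo s (3 * s))).prod (volume.restrict (Ioo 0 π))) := by
    rw [Measure.prod_restrict]
    have : ContinuousOn (fun p : ℝ × ℝ => p.1 * G (P p)) (Ioo s (3 * s) ×ˢ Ioo 0 π) :=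
      continuousOn_fst.mul
        (hG.comp hPc.continuousOn fun p hp => mul_exp_mem_halfAnnulus hs hp.1 hp.2)
    exact (this.aemeasurable (measurableSet_Ioo.prod measurableSet_Ioo)).ennreal_ofReal
  rw [← lintegral_prod (fun p : ℝ × ℝ => ENNReal.ofReal (p.1 * G (P p))) hmeas,
    Measure.prod_restrict, ← Measure.volume_eq_prod,
    ← lintegral_indicator (isOpen_halfAnnulus s).measurableSet,
    ← Complex.lintegral_comp_polarCoord_symm, polarCoord_target]
  have hsub : Ioo s (3 * s) ×ˢ Ioo 0 π ⊆ Ioi (0 : ℝ) ×ˢ Ioo (-π) π :=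
    prod_mono (fun x hx => hs.trans hx.1) (Ioo_subset_Ioo_left (by linarith [pi_pos]))
  refine le_trans (le_of_eq ?_) (lintegral_mono_set hsub)
  refine setLIntegral_congr_fun (measurableSet_Ioo.prod measurableSet_Ioo) fun p hp => ?_
  have hp' : Complex.polarCoord.symm p = P p := by
    simp [Complex.polarCoord_symm_apply, hP, Complex.exp_mul_I]
  simp only [hp', smul_eq_mul]
  rw [indicator_of_mem (mul_exp_mem_halfAnnulus hs hp.1 hp.2),
    ENNReal.ofReal_mul (hs.trans hp.1.1).le]

lemma exists_hasDerivAt_annulusPotential_comp {r R : ℝ} (hr : 0 < r) (hR : r ≤ R) {γ : ℝ → ℂ}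
    {v : ℂ} {y : ℝ} (hγ : HasDerivAt γ v y) :
    ∃ d : ℝ, HasDerivAt (fun u => annulusPotential r R (γ u)) d y ∧
      d ^ 2 ≤ annulusDensitySq r R (γ y) * ‖v‖ ^ 2 := by
  have hN := hγ.norm_sq
  have hR0 : 0 < R := hr.trans_le hR
  have p1 : 0 < ‖γ y‖ ^ 2 + r ^ 2 := by positivity
  have p2 : 0 < ‖γ y‖ ^ 2 + R ^ 2 := by positivity
  refine ⟨_, ((hN.add_const (r ^ 2)).log p1.ne').sub ((hN.add_const (R ^ 2)).log p2.ne'), ?_⟩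
  set i : ℝ := inner ℝ (γ y) v
  have hi : i ^ 2 ≤ ‖γ y‖ ^ 2 * ‖v‖ ^ 2 := by
    rw [← mul_pow]
    exact sq_le_sq' (by linarith [neg_le_of_abs_le (abs_real_inner_le_norm (γ y) v)])
      (real_inner_le_norm _ _)
  set N : ℝ := ‖γ y‖ ^ 2
  have hN0 : 0 ≤ N := sq_nonneg _
  have h1 : (R ^ 2 - r ^ 2) ^ 2 ≤ R ^ 2 * R ^ 2 := by
    have : r ^ 2 ≤ R ^ 2 := by gcongr
    nlinarith [sq_nonneg r, sq_nonneg R]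
  have h2 : N * (R ^ 2 - r ^ 2) ^ 2 ≤ R ^ 2 * ((N + r ^ 2) * (N + R ^ 2)) := by
    calc N * (R ^ 2 - r ^ 2) ^ 2 ≤ N * (R ^ 2 * R ^ 2) := by gcongr
      _ = R ^ 2 * (N * R ^ 2) := by ring
      _ ≤ _ := by gcongr <;> nlinarith [sq_nonneg r, sq_nonneg R]
  have h3 : i ^ 2 * (R ^ 2 - r ^ 2) ^ 2 ≤ ‖v‖ ^ 2 * (R ^ 2 * ((N + r ^ 2) * (N + R ^ 2))) := by
    calc i ^ 2 * (R ^ 2 - r ^ 2) ^ 2 ≤ (N * ‖v‖ ^ 2) * (R ^ 2 - r ^ 2) ^ 2 := by gcongr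
      _ = ‖v‖ ^ 2 * (N * (R ^ 2 - r ^ 2) ^ 2) := by ring
      _ ≤ _ := by gcongr
  have h4 : (2 * i / (N + r ^ 2) - 2 * i / (N + R ^ 2)) ^ 2 =
      4 * (i ^ 2 * (R ^ 2 - r ^ 2) ^ 2) / ((N + r ^ 2) * (N + R ^ 2)) ^ 2 := by
    field_simp
    ring
  rw [h4, annulusDensitySq, div_mul_eq_mul_div, div_le_div_iff₀ (by positivity) (by positivity)]
  change 4 * (i ^ 2 * (R ^ 2 - r ^ 2) ^ 2) * ((N + r ^ 2) * (N + R ^ 2)) ≤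
    4 * R ^ 2 * ‖v‖ ^ 2 * ((N + r ^ 2) * (N + R ^ 2)) ^ 2
  have h5 := mul_le_mul_of_nonneg_right h3 (mul_pos p1 p2).le
  linarith

lemma ofReal_sq_div_le_lintegral_annulusDensitySq {r R Λ a b : ℝ} (hr : 0 < r) (hR : r ≤ R)
    (hab : a < b) (hΛ : 0 < Λ) {γ γ' : ℝ → ℂ} (hγ : ContinuousOn γ (Icc a b))
    (hγd : ∀ y ∈ Ioo a b, HasDerivAt γ (γ' y) y) (hγ' : ContinuousOn γ' (Ioo a b))
    (h : Λ ≤ |annulusPotential r R (γ b) - annulusPotential r R (γ a)|) :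
    ENNReal.ofReal (Λ ^ 2 / (b - a)) ≤
      ∫⁻ y in Ioo a b, ENNReal.ofReal (annulusDensitySq r R (γ y) * ‖γ' y‖ ^ 2) := by
  have hR0 : 0 < R := hr.trans_le hR
  have hba : 0 < b - a := sub_pos.2 hab
  set q : ℝ → ℝ := fun y => annulusDensitySq r R (γ y) * ‖γ' y‖ ^ 2 with hq
  have hq0 : ∀ y, 0 ≤ q y := fun y => mul_nonneg (annulusDensitySq_nonneg _ _ _) (sq_nonneg _)
  have hqc : ContinuousOn q (Ioo a b) :=
    ((continuous_annulusDensitySq hr hR0).comp_continuousOn (hγ.mono Ioo_subset_Icc_self)).mul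
      (hγ'.norm.pow 2)
  by_cases hfin : ∫⁻ y in Ioo a b, ENNReal.ofReal (q y) = ⊤
  · rw [hfin]; exact le_top
  have hqi : IntegrableOn q (Ioo a b) := by
    refine ⟨hqc.aestronglyMeasurable measurableSet_Ioo, ?_⟩
    rw [hasFiniteIntegral_iff_ofReal (Eventually.of_forall hq0)]
    exact lt_top_iff_ne_top.2 hfin
  rw [← ofReal_integral_eq_lintegral_ofReal hqi (Eventually.of_forall hq0)]
  apply ENNReal.ofReal_le_ofReal
  set k : ℝ := Λ / (b - a) with hk
  have hk0 : 0 < k := div_pos hΛ hba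
  set φ : ℝ → ℝ := fun y => k / 2 + (1 / (2 * k)) * q y with hφ
  have hφi : IntegrableOn φ (Icc a b) := by
    rw [integrableOn_Icc_iff_integrableOn_Ioo]
    exact (integrable_const _).add (hqi.const_mul _)
  have hφint : ∫ y in a..b, φ y = Λ / 2 + (1 / (2 * k)) * ∫ y in Ioo a b, q y := by
    rw [intervalIntegral.integral_of_le hab.le, integral_Ioc_eq_integral_Ioo,
      integral_add (integrable_const _) (hqi.const_mul _), integral_const_mul]
    simp [hk, hba.le]
    field_simp
  have hd : ∀ y ∈ Ioo a b, ∃ d : ℝ, HasDerivAt (fun u => annulusPotential r R (γ u)) d y ∧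
      |d| ≤ φ y := by
    intro y hy
    obtain ⟨d, hd, hd2⟩ := exists_hasDerivAt_annulusPotential_comp hr hR (hγd y hy)
    refine ⟨d, hd, ?_⟩
    have h1 : 2 * k * |d| ≤ k ^ 2 + q y := by
      have := sq_nonneg (k - |d|)
      have h3 := sq_abs d
      have h4 : d ^ 2 ≤ q y := hd2
      nlinarith
    have h2 : φ y = (k ^ 2 + q y) / (2 * k) := by simp only [hφ]; field_simp
    rw [h2, le_div_iff₀ (by positivity)]
    linarith
  have hpc : ContinuousOn (fun u => annulusPotential r R (γ u)) (Icc a b) :=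
    (continuous_annulusPotential hr hR0).comp_continuousOn hγ
  choose! d hd hdφ using hd
  have hle : |annulusPotential r R (γ b) - annulusPotential r R (γ a)| ≤ ∫ y in a..b, φ y := by
    rw [abs_le']
    constructor
    · exact intervalIntegral.sub_le_integral_of_hasDeriv_right_of_le hab.le hpc
        (fun y hy => (hd y hy).hasDerivWithinAt) hφi
        (fun y hy => (le_abs_self _).trans (hdφ y hy))
    · have := intervalIntegral.sub_le_integral_of_hasDeriv_right_of_le hab.le hpc.neg
        (fun y hy => (hd y hy).neg.hasDerivWithinAt) hφi
        (fun y hy => (neg_le_abs _).trans (hdφ y hy))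
      simp only [Pi.neg_apply] at this
      linarith
  rw [hφint] at hle
  have h5 : Λ / 2 ≤ 1 / (2 * k) * ∫ y in Ioo a b, q y := by linarith
  rw [one_div_mul_eq_div, div_le_div_iff₀ two_pos (by positivity)] at h5
  have h6 : Λ * k ≤ ∫ y in Ioo a b, q y := by linarith
  calc Λ ^ 2 / (b - a) = Λ * k := by rw [hk]; ring
    _ ≤ _ := h6

lemma log_div_le_annulusPotential_sub {r R : ℝ} (hr : 0 < r) (hR : 4 * r ≤ R) {w w' : ℂ}
    (hw : ‖w‖ ≤ r) (hw' : R ≤ ‖w'‖) :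
    log (R / r) ≤ annulusPotential r R w' - annulusPotential r R w := by
  have hR0 : 0 < R := by linarith
  unfold annulusPotential
  have a1 : 0 < ‖w‖ ^ 2 + r ^ 2 := by positivity
  have a2 : 0 < ‖w‖ ^ 2 + R ^ 2 := by positivity
  have a3 : 0 < ‖w'‖ ^ 2 + r ^ 2 := by positivity
  have a4 : 0 < ‖w'‖ ^ 2 + R ^ 2 := by positivity
  have e1 : R / r * ((‖w‖ ^ 2 + r ^ 2) / (‖w‖ ^ 2 + R ^ 2)) ≤ 1 / 2 := by
    have h1 : (‖w‖ ^ 2 + r ^ 2) / (‖w‖ ^ 2 + R ^ 2) ≤ 2 * r ^ 2 / R ^ 2 := by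
      have : ‖w‖ ^ 2 ≤ r ^ 2 := by gcongr
      gcongr <;> nlinarith [sq_nonneg ‖w‖]
    calc _ ≤ R / r * (2 * r ^ 2 / R ^ 2) := by gcongr
      _ = 2 * r / R := by field_simp
      _ ≤ 1 / 2 := by rw [div_le_div_iff₀ hR0 two_pos]; linarith
  have e2 : 1 / 2 ≤ (‖w'‖ ^ 2 + r ^ 2) / (‖w'‖ ^ 2 + R ^ 2) := by
    have : R ^ 2 ≤ ‖w'‖ ^ 2 := by gcongr
    rw [div_le_div_iff₀ two_pos a4]
    nlinarith [sq_nonneg r]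
  rw [← log_div a3.ne' a4.ne', ← log_div a1.ne' a2.ne', le_sub_iff_add_le,
    ← log_mul (by positivity) (by positivity)]
  exact log_le_log (by positivity) (e1.trans e2)

/-- Length-area estimate: if an injective holomorphic map of a half annulus sends one of the two
bounding segments into the disk of radius `r` and the other one outside the disk of radius `R`,
then `R / r` is bounded by an absolute constant. -/
lemma le_exp_mul_of_injOn_halfAnnulus {s r R : ℝ} (hs : 0 < s) (hr : 0 < r) {F : ℂ → ℂ}
    (hFd : DifferentiableOn ℂ F (halfAnnulus s)) (hFi : InjOn F (halfAnnulus s))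
    (hFc : ∀ x ∈ Ioo s (3 * s),
      ContinuousOn (fun y : ℝ => F (x * Complex.exp (y * Complex.I))) (Icc 0 π))
    (hF : ∀ x ∈ Ioo s (3 * s),
      (‖F x‖ ≤ r ∧ R ≤ ‖F (-x)‖) ∨ (‖F (-x)‖ ≤ r ∧ R ≤ ‖F x‖)) :
    R ≤ exp (16 * π ^ 2) * r := by
  by_cases hR : 4 * r ≤ R
  swap
  · have h1 : 16 * π ^ 2 + 1 ≤ exp (16 * π ^ 2) := add_one_le_exp _
    have h2 : 4 ≤ exp (16 * π ^ 2) := by nlinarith [pi_gt_three]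
    nlinarith
  have hR0 : 0 < R := by linarith
  set Λ := log (R / r) with hΛ
  have hΛ0 : 0 < Λ := log_pos (by rw [lt_div_iff₀ hr]; linarith)
  set G : ℂ → ℝ := fun z => annulusDensitySq r R (F z) * ‖deriv F z‖ ^ 2 with hG
  have hopen := isOpen_halfAnnulus s
  have hderc : ContinuousOn (deriv F) (halfAnnulus s) := (hFd.deriv hopen).continuousOn
  have hGc : ContinuousOn G (halfAnnulus s) :=
    ((continuous_annulusDensitySq hr hR0).comp_continuousOn hFd.continuousOn).mul
      (hderc.norm.pow 2)
  have hup : ∫⁻ z in halfAnnulus s, ENNReal.ofReal (G z) ≤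
      ENNReal.ofReal (32 * π / 3 * Λ) := by
    refine le_trans (le_of_eq ?_) ((lintegral_normSq_deriv_mul_comp_le hopen hFd hFi
      fun w => ENNReal.ofReal (annulusDensitySq r R w)).trans
        (lintegral_annulusDensitySq_le hr (by linarith)))
    refine lintegral_congr fun z => ?_
    rw [← ENNReal.ofReal_mul (by positivity), mul_comm]
  have hlow : ∀ x ∈ Ioo s (3 * s), ENNReal.ofReal (Λ ^ 2 / (3 * s * π)) ≤
      ∫⁻ y in Ioo 0 π, ENNReal.ofReal (x * G (x * Complex.exp (y * Complex.I))) := by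
    intro x hx
    have hx0 : 0 < x := hs.trans hx.1
    set e : ℝ → ℂ := fun y => x * Complex.exp (y * Complex.I) with he
    have hec : Continuous e := by fun_prop
    have hed : ∀ y : ℝ, HasDerivAt e (x * (Complex.exp (y * Complex.I) * Complex.I)) y := by
      intro y
      have h1 : HasDerivAt (fun z : ℂ => z * Complex.I) Complex.I (y : ℂ) := by
        simpa using (hasDerivAt_id (y : ℂ)).mul_const Complex.I
      exact (h1.cexp.const_mul (x : ℂ)).comp_ofReal
    have hem : MapsTo e (Ioo 0 π) (halfAnnulus s) := fun y hy => mul_exp_mem_halfAnnulus hs hx hy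
    have hne : ∀ y : ℝ, ‖x * (Complex.exp (y * Complex.I) * Complex.I)‖ = x := by
      intro y
      rw [norm_mul, norm_mul, Complex.norm_exp_ofReal_mul_I, Complex.norm_I, Complex.norm_real,
        Real.norm_of_nonneg hx0.le, one_mul, mul_one]
    have key := ofReal_sq_div_le_lintegral_annulusDensitySq (r := r) (R := R) (Λ := Λ)
      (γ := fun y => F (e y))
      (γ' := fun y => deriv F (e y) * (x * (Complex.exp (y * Complex.I) * Complex.I)))
      hr (by linarith) pi_pos hΛ0 (hFc x hx)
      (fun y hy => ((hFd.differentiableAt (hopen.mem_nhds (hem hy))).hasDerivAt.comp y (hed y)))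
      ((hderc.comp hec.continuousOn hem).mul (by fun_prop)) ?_
    · calc ENNReal.ofReal (Λ ^ 2 / (3 * s * π))
          = ENNReal.ofReal (1 / (3 * s)) * ENNReal.ofReal (Λ ^ 2 / (π - 0)) := by
            rw [← ENNReal.ofReal_mul (by positivity)]
            congr 1
            field_simp
            ring
        _ ≤ _ := mul_le_mul' le_rfl key
        _ = ∫⁻ y in Ioo 0 π, ENNReal.ofReal (1 / (3 * s) * (annulusDensitySq r R (F (e y)) *
              ‖deriv F (e y) * (x * (Complex.exp (y * Complex.I) * Complex.I))‖ ^ 2)) := by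
            rw [← lintegral_const_mul' _ _ ENNReal.ofReal_ne_top]
            refine lintegral_congr fun y => ?_
            rw [← ENNReal.ofReal_mul (by positivity)]
        _ ≤ _ := by
            refine lintegral_mono fun y => ENNReal.ofReal_le_ofReal ?_
            rw [norm_mul, hne, mul_pow, ← mul_assoc (annulusDensitySq r R (F (e y)))]
            change 1 / (3 * s) * (G (e y) * x ^ 2) ≤ x * G (e y)
            have hG0 : 0 ≤ G (e y) := mul_nonneg (annulusDensitySq_nonneg _ _ _) (sq_nonneg _)
            have h1 : 1 / (3 * s) * x ≤ 1 := by
              rw [one_div_mul_eq_div, div_le_one (by positivity)]; exact hx.2.le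
            calc 1 / (3 * s) * (G (e y) * x ^ 2) = (1 / (3 * s) * x) * (x * G (e y)) := by ring
              _ ≤ 1 * (x * G (e y)) := by gcongr
              _ = _ := one_mul _
    · simp only [he, Complex.exp_pi_mul_I, Complex.ofReal_zero, zero_mul, Complex.exp_zero,
        mul_one, mul_neg]
      rcases hF x hx with h | h
      · exact (log_div_le_annulusPotential_sub hr hR h.1 h.2).trans (le_abs_self _)
      · rw [abs_sub_comm]
        exact (log_div_le_annulusPotential_sub hr hR h.1 h.2).trans (le_abs_self _)
  have hmain : ENNReal.ofReal (2 * Λ ^ 2 / (3 * π)) ≤ ENNReal.ofReal (32 * π / 3 * Λ) := by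
    calc ENNReal.ofReal (2 * Λ ^ 2 / (3 * π))
        = ∫⁻ x in Ioo s (3 * s), ENNReal.ofReal (Λ ^ 2 / (3 * s * π)) := by
          rw [setLIntegral_const, Real.volume_Ioo, ← ENNReal.ofReal_mul (by positivity)]
          congr 1
          field_simp
          ring
      _ ≤ _ := setLIntegral_mono' measurableSet_Ioo hlow
      _ ≤ _ := (lintegral_polar_halfAnnulus_le hs hGc).trans hup
  rw [ENNReal.ofReal_le_ofReal_iff (by positivity), div_le_iff₀ (by positivity)] at hmain
  have hΛle : Λ ≤ 16 * π ^ 2 := by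
    have : Λ * Λ ≤ 16 * π ^ 2 * Λ := by nlinarith
    exact le_of_mul_le_mul_right this hΛ0
  rw [← div_le_iff₀ hr, ← log_le_iff_le_exp (by positivity)]
  exact hΛle

lemma IsJordanParam.eq_of_abs_sub_lt {p : ℝ → ℂ} (hp : IsJordanParam p) {s t : ℝ}
    (h : p s = p t) (hst : |s - t| < 2 * π) : s = t := by
  obtain ⟨-, hper, hinj⟩ := hp
  have e : toIcoMod two_pi_pos 0 s = toIcoMod two_pi_pos 0 t := by
    refine hinj (by simpa using toIcoMod_mem_Ico two_pi_pos 0 s)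
      (by simpa using toIcoMod_mem_Ico two_pi_pos 0 t) ?_
    have h1 : ∀ u, p (toIcoMod two_pi_pos 0 u) = p u := fun u => by
      rw [toIcoMod]; exact hper.sub_zsmul_eq _
    rw [h1, h1, h]
  obtain ⟨n, hn⟩ := (toIcoMod_eq_toIcoMod two_pi_pos).1 e
  have hn0 : n = 0 := by
    rw [abs_sub_comm, hn, zsmul_eq_mul, abs_mul, abs_of_pos two_pi_pos] at hst
    have : |(n : ℝ)| < 1 := by
      by_contra! hc
      nlinarith [two_pi_pos]
    exact_mod_cast Int.abs_lt_one_iff.1 (by exact_mod_cast this)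
  rw [hn0] at hn
  simp only [zero_smul] at hn
  linarith

lemma IsJordanParam.isCompact_range {p : ℝ → ℂ} (hp : IsJordanParam p) :
    IsCompact (range p) := by
  rw [← hp.2.1.image_Icc two_pi_pos 0]
  exact isCompact_Icc.image hp.1

/-- A Jordan curve contained in another Jordan curve is all of it. -/
lemma IsJordanParam.range_eq_of_subset {p h : ℝ → ℂ} (hp : IsJordanParam p)
    (hh : IsJordanParam h) (hsub : range h ⊆ range p) : range h = range p := by
  refine hsub.antisymm ?_
  rintro _ ⟨s, rfl⟩
  by_contra hs
  set K : Set ℝ := Icc s (s + 2 * π) ∩ p ⁻¹' range h with hK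
  have hKc : IsCompact K := isCompact_Icc.inter_right (hh.isCompact_range.isClosed.preimage hp.1)
  have hne : ∀ u ∈ K, s < u ∧ u < s + 2 * π := by
    rintro u ⟨hu, hu'⟩
    constructor
    · refine lt_of_le_of_ne hu.1 ?_
      rintro rfl
      exact hs hu'
    · refine lt_of_le_of_ne hu.2 ?_
      rintro rfl
      rw [mem_preimage, hp.2.1 s] at hu'
      exact hs hu'
  have hinj : Function.Injective (K.domRestrict p) := by
    rintro ⟨u, hu⟩ ⟨v, hv⟩ huv
    have h1 := hne u hu
    have h2 := hne v hv
    exact Subtype.ext (hp.eq_of_abs_sub_lt huv (abs_lt.2 ⟨by linarith, by linarith⟩))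
  have : CompactSpace K := isCompact_iff_compactSpace.1 hKc
  have hemb := (hp.1.continuousOn (s := K)).domRestrict.isClosedEmbedding hinj
  have hex : ∀ θ, ∃ u : K, p u = h θ := by
    intro θ
    have h1 : h θ ∈ p '' Icc s (s + 2 * π) := by
      rw [hp.2.1.image_Icc two_pi_pos s]
      exact hsub ⟨θ, rfl⟩
    obtain ⟨u, hu, hu'⟩ := h1
    exact ⟨⟨u, hu, θ, hu'.symm⟩, hu'⟩
  choose q hq using hex
  have hqc : Continuous q := by
    rw [hemb.isInducing.continuous_iff]
    exact hh.1.congr fun θ => (hq θ).symm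
  have hq2 : q (π + π) = q 0 := by
    apply hinj
    change p (q (π + π)) = p (q 0)
    rw [hq, hq, ← two_mul, ← hh.2.1 0, zero_add]
  have hdc : Continuous fun θ : ℝ => (q (θ + π) : ℝ) - q θ := by fun_prop
  have h0 : (0 : ℝ) ∈ uIcc ((q (0 + π) : ℝ) - q 0) ((q (π + π) : ℝ) - q π) := by
    rw [hq2, zero_add, mem_uIcc]
    rcases le_total (q π : ℝ) (q 0) with h | h
    · exact Or.inl ⟨by linarith, by linarith⟩
    · exact Or.inr ⟨by linarith, by linarith⟩
  obtain ⟨θ, -, hθ⟩ := intermediate_value_uIcc hdc.continuousOn h0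
  have h1 : q (θ + π) = q θ := Subtype.ext (sub_eq_zero.1 hθ)
  have h2 : h (θ + π) = h θ := by rw [← hq, ← hq, h1]
  have := hh.eq_of_abs_sub_lt h2 (by simp [abs_of_pos pi_pos, pi_pos])
  linarith [pi_pos]

lemma IsJordanParam.comp_add_mul {p : ℝ → ℂ} (hp : IsJordanParam p) (c : ℝ) {ε : ℝ}
    (hε : ε = 1 ∨ ε = -1) :
    IsJordanParam (fun θ => p (c + ε * θ)) ∧ range (fun θ => p (c + ε * θ)) = range p := by
  have hε2 : ε * ε = 1 := by rcases hε with rfl | rfl <;> norm_num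
  have hεa : |ε| = 1 := by rcases hε with rfl | rfl <;> norm_num
  refine ⟨⟨hp.1.comp (by fun_prop), fun θ => ?_, fun u hu v hv huv => ?_⟩, ?_⟩
  · rcases hε with rfl | rfl
    · have := hp.2.1 (c + 1 * θ)
      simp only [one_mul] at this ⊢
      rw [← add_assoc, this]
    · have := hp.2.1.sub_eq (c + -1 * θ)
      simp only
      rw [← this]
      congr 1
      ring
  · have := hp.eq_of_abs_sub_lt huv (by
      rw [show c + ε * u - (c + ε * v) = ε * (u - v) by ring, abs_mul, hεa, one_mul, abs_lt]
      exact ⟨by linarith [hu.1, hv.2], by linarith [hu.2, hv.1]⟩)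
    have h1 : ε * (u - v) = 0 := by linarith
    have h2 : u - v = 0 := by
      calc u - v = ε * (ε * (u - v)) := by rw [← mul_assoc, hε2, one_mul]
        _ = 0 := by rw [h1, mul_zero]
    linarith
  · apply Subset.antisymm
    · rintro _ ⟨θ, rfl⟩; exact ⟨_, rfl⟩
    · rintro _ ⟨θ, rfl⟩
      refine ⟨ε * (θ - c), ?_⟩
      simp only
      rw [← mul_assoc, hε2]
      congr 1
      ring

/-- In a `t`-quasicircle, one of the two arcs between two parameters is small. -/
lemma IsJordanParam.dist_le_or_dist_le {g : ℝ → ℂ} (hg : IsJordanParam g) {t C : ℝ}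
    (hC : TQuasicircleCond t C (range g)) (α β : ℝ) :
    (∀ u ∈ Icc α β, ∀ v ∈ Icc α β, dist (g u) (g v) ≤ C * dist (g α) (g β) ^ t) ∨
    (∀ u ∈ Icc β (α + 2 * π), ∀ v ∈ Icc β (α + 2 * π),
      dist (g u) (g v) ≤ C * dist (g α) (g β) ^ t) := by
  obtain ⟨A, ⟨p, hp, hpr, a, b, hab, -, hpa, hpb, rfl⟩, hA⟩ :=
    hC (g α) ⟨α, rfl⟩ (g β) ⟨β, rfl⟩
  set A := p '' Icc a b
  have hAc : IsCompact A := isCompact_Icc.image hp.1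
  have hAp : IsPreconnected A := isPreconnected_Icc.image _ hp.1.continuousOn
  have hαA : g α ∈ A := ⟨a, ⟨le_rfl, hab⟩, hpa⟩
  have hβA : g β ∈ A := ⟨b, ⟨hab, le_rfl⟩, hpb⟩
  have hmain : (∀ u ∈ Icc α β, g u ∈ A) ∨ (∀ v ∈ Icc β (α + 2 * π), g v ∈ A) := by
    by_contra! hcon
    obtain ⟨⟨u, hu, huA⟩, v, hv, hvA⟩ := hcon
    have huβ : u < β := lt_of_le_of_ne hu.2 fun h => huA (h ▸ hβA)
    have hαu : α < u := lt_of_le_of_ne hu.1 fun h => huA (h ▸ hαA)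
    have hβv : β < v := lt_of_le_of_ne hv.1 fun h => hvA (h ▸ hβA)
    have hvα : v < α + 2 * π := lt_of_le_of_ne hv.2 fun h => hvA (by
      rw [h, hg.2.1 α]; exact hαA)
    have hcov : A ⊆ g '' Icc u v ∪ g '' Icc v (u + 2 * π) := by
      rw [← image_union, Icc_union_Icc_eq_Icc (by linarith) (by linarith),
        hg.2.1.image_Icc two_pi_pos u, ← hpr]
      exact image_subset_range _ _
    obtain ⟨z, hzA, ⟨s, hs, hsz⟩, ⟨s', hs', hsz'⟩⟩ := isPreconnected_closed_iff.1 hAp _ _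
      (isCompact_Icc.image hg.1).isClosed (isCompact_Icc.image hg.1).isClosed hcov
      ⟨g β, hβA, β, ⟨huβ.le, hβv.le⟩, rfl⟩
      ⟨g α, hαA, α + 2 * π, ⟨hvα.le, by linarith⟩, hg.2.1 α⟩
    have hsu : s ≠ u := by rintro rfl; exact huA (hsz ▸ hzA)
    have hus : u < s := lt_of_le_of_ne hs.1 hsu.symm
    have hss := hg.eq_of_abs_sub_lt (hsz.trans hsz'.symm)
      (abs_lt.2 ⟨by linarith [hs'.2], by linarith [hs.2, hs'.1, two_pi_pos]⟩)
    have hsv : s = v := le_antisymm hs.2 (hss ▸ hs'.1)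
    exact hvA (by rw [← hsv, hsz]; exact hzA)
  rcases hmain with h | h
  · exact Or.inl fun u hu v hv => (dist_le_diam_of_mem hAc.isBounded (h u hu) (h v hv)).trans hA
  · exact Or.inr fun u hu v hv => (dist_le_diam_of_mem hAc.isBounded (h u hu) (h v hv)).trans hA

lemma mem_of_mem_closure_of_notMem_connectedComponentIn {Γ : Set ℂ} {x z : ℂ}
    (hz : z ∈ closure (connectedComponentIn Γᶜ x)) (hz' : z ∉ connectedComponentIn Γᶜ x) :
    z ∈ Γ := by
  by_contra hzΓ
  have hx : x ∈ Γᶜ := by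
    by_contra hx
    rw [connectedComponentIn_eq_empty hx, closure_empty] at hz
    exact hz
  have hpre : IsPreconnected (insert z (connectedComponentIn Γᶜ x)) :=
    isPreconnected_connectedComponentIn.subset_closure (subset_insert _ _)
      (insert_subset hz subset_closure)
  exact hz' (hpre.subset_connectedComponentIn
    (mem_insert_of_mem _ (mem_connectedComponentIn hx))
    (insert_subset hzΓ (connectedComponentIn_subset _ _)) (mem_insert _ _))

lemma exp_ofReal_mul_I_mem_sphere (θ : ℝ) :
    Complex.exp (θ * Complex.I) ∈ sphere (0 : ℂ) 1 := by
  simp [Complex.norm_exp_ofReal_mul_I]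

lemma isJordanParam_comp_exp {f : ℂ → ℂ} (hfc : ContinuousOn f (sphere (0 : ℂ) 1))
    (hfi : InjOn f (sphere (0 : ℂ) 1)) :
    IsJordanParam (fun θ : ℝ => f (Complex.exp (θ * Complex.I))) := by
  refine ⟨hfc.comp_continuous (by fun_prop) exp_ofReal_mul_I_mem_sphere, fun θ => ?_,
    fun u hu v hv huv => ?_⟩
  · simp only
    congr 1
    push_cast
    rw [add_mul, Complex.exp_periodic]
  · have h1 := hfi (exp_ofReal_mul_I_mem_sphere u) (exp_ofReal_mul_I_mem_sphere v) huv
    obtain ⟨n, hn⟩ := Complex.exp_eq_exp_iff_exists_int.1 h1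
    have h2 : u = v + n * (2 * π) := by
      have := congrArg Complex.im hn
      simpa using this
    have hu1 := hu.1
    have hu2 := hu.2
    have hv1 := hv.1
    have hv2 := hv.2
    have hn1 : (n : ℝ) < 1 := by
      by_contra! hc
      nlinarith [two_pi_pos]
    have hn2 : (-1 : ℝ) < n := by
      by_contra! hc
      nlinarith [two_pi_pos]
    have hn0 : n = 0 := by
      have a1 : n < 1 := by exact_mod_cast hn1
      have a2 : -1 < n := by exact_mod_cast hn2
      omega
    rw [h2, hn0]; simp

lemma exp_mul_I_inj_of_abs_re_lt_pi {ζ ω : ℂ} (hζ : |ζ.re| < π) (hω : |ω.re| < π)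
    (h : Complex.exp (ζ * Complex.I) = Complex.exp (ω * Complex.I)) : ζ = ω := by
  have h1 := Complex.exp_inj_of_neg_pi_lt_of_le_pi (x := ζ * Complex.I) (y := ω * Complex.I)
    (by simpa using (abs_lt.1 hζ).1) (by simpa using (abs_lt.1 hζ).2.le)
    (by simpa using (abs_lt.1 hω).1) (by simpa using (abs_lt.1 hω).2.le) h
  exact mul_right_cancel₀ Complex.I_ne_zero h1

/-- The length-area estimate for adjacent arcs of equal length on the unit circle. -/
lemma le_exp_mul_of_adjacent_arcs {f : ℂ → ℂ}
    (hfc : ContinuousOn f (closedBall (0 : ℂ) 1)) (hfd : DifferentiableOn ℂ f (ball (0 : ℂ) 1))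
    (hfi : InjOn f (closedBall (0 : ℂ) 1)) {ξ ε β r R : ℝ} (hε : ε = 1 ∨ ε = -1) (hβ : 0 < β)
    (hβ' : β ≤ π / 2) (hr : 0 < r) {w : ℂ}
    (hnear : ∀ u ∈ Icc 0 β,
      dist (f (Complex.exp ((ξ + ε * u : ℝ) * Complex.I))) w ≤ r)
    (hfar : ∀ v ∈ Icc β (2 * β),
      R ≤ dist (f (Complex.exp ((ξ + ε * -v : ℝ) * Complex.I))) w) :
    R ≤ exp (16 * π ^ 2) * r := by
  set c : ℝ := ξ - ε * (β / 2) with hc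
  set e : ℂ → ℂ := fun ζ => Complex.exp ((c + ζ) * Complex.I) with he
  have hen : ∀ ζ, ‖e ζ‖ = exp (-ζ.im) := by
    intro ζ
    simp [he, Complex.norm_exp]
  have hec : Continuous e := by fun_prop
  have hed : Differentiable ℂ e := by fun_prop
  have hmem : ∀ ζ ∈ halfAnnulus (β / 2), e ζ ∈ ball (0 : ℂ) 1 := by
    intro ζ hζ
    rw [mem_ball_zero_iff, hen, exp_lt_one_iff]
    linarith [hζ.2.2]
  have hmem' : ∀ ζ : ℂ, 0 ≤ ζ.im → e ζ ∈ closedBall (0 : ℂ) 1 := by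
    intro ζ hζ
    rw [mem_closedBall_zero_iff, hen, exp_le_one_iff]
    linarith
  have hre : ∀ ζ ∈ halfAnnulus (β / 2), |ζ.re| < π := fun ζ hζ =>
    (Complex.abs_re_le_norm ζ).trans_lt (by linarith [hζ.2.1, pi_pos])
  refine le_exp_mul_of_injOn_halfAnnulus (s := β / 2) (F := fun ζ => f (e ζ) - w)
    (by positivity) hr ?_ ?_ ?_ ?_
  · exact (hfd.comp hed.differentiableOn hmem).sub_const w
  · intro ζ hζ ω hω h
    have h1 := hfi (ball_subset_closedBall (hmem ζ hζ)) (ball_subset_closedBall (hmem ω hω))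
      (sub_left_injective h)
    simp only [he, add_mul, Complex.exp_add] at h1
    exact exp_mul_I_inj_of_abs_re_lt_pi (hre ζ hζ) (hre ω hω)
      (mul_left_cancel₀ (Complex.exp_ne_zero _) h1)
  · intro x hx
    refine (hfc.comp (hec.comp (by fun_prop)).continuousOn fun y hy => hmem' _ ?_).sub
      continuousOn_const
    rw [Complex.im_ofReal_mul, Complex.exp_ofReal_mul_I_im]
    exact mul_nonneg (by linarith [hx.1]) (sin_nonneg_of_nonneg_of_le_pi hy.1 hy.2)
  · intro x hx
    have hN := hnear (x - β / 2) ⟨by linarith [hx.1], by linarith [hx.2]⟩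
    have hR := hfar (x + β / 2) ⟨by linarith [hx.1], by linarith [hx.2]⟩
    rw [dist_eq_norm] at hN hR
    have a1 : Complex.exp ((ξ + ε * (x - β / 2) : ℝ) * Complex.I) = e ((ε * x : ℝ) : ℂ) := by
      simp only [he, hc]; congr 2; push_cast; ring
    have a2 : Complex.exp ((ξ + ε * -(x + β / 2) : ℝ) * Complex.I) = e (-((ε * x : ℝ) : ℂ)) := by
      simp only [he, hc]; congr 2; push_cast; ring
    rw [a1] at hN
    rw [a2] at hR
    rcases hε with rfl | rfl
    · left; simpa using And.intro hN hR
    · right; simpa using And.intro hN hR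

lemma eq_or_eq_conj_of_norm_sub_one_eq {u v : ℂ} (hu : ‖u‖ = 1) (hv : ‖v‖ = 1)
    (h : ‖u - 1‖ = ‖v - 1‖) : u = v ∨ u = (starRingEnd ℂ) v := by
  have h1 : u.re * u.re + u.im * u.im = 1 := by
    rw [← Complex.normSq_apply, Complex.normSq_eq_norm_sq, hu, one_pow]
  have h2 : v.re * v.re + v.im * v.im = 1 := by
    rw [← Complex.normSq_apply, Complex.normSq_eq_norm_sq, hv, one_pow]
  have h3 : (u - 1).re * (u - 1).re + (u - 1).im * (u - 1).im =
      (v - 1).re * (v - 1).re + (v - 1).im * (v - 1).im := by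
    rw [← Complex.normSq_apply, ← Complex.normSq_apply, Complex.normSq_eq_norm_sq,
      Complex.normSq_eq_norm_sq, h]
  simp only [Complex.sub_re, Complex.sub_im, Complex.one_re, Complex.one_im, sub_zero] at h3
  have hre : u.re = v.re := by linarith
  have him : u.im * u.im = v.im * v.im := by rw [hre] at h1; linarith
  rcases mul_self_eq_mul_self_iff.1 him with h4 | h4
  · exact Or.inl (Complex.ext hre h4)
  · exact Or.inr (Complex.ext (by simpa using hre) (by simpa using h4))

/-- Two distinct points of the unit circle equidistant from a third one sit at opposite angles. -/
lemma exists_angles_of_dist_eq {a b x : ℂ} (ha : a ∈ sphere (0 : ℂ) 1) (hb : b ∈ sphere (0 : ℂ) 1)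
    (hx : x ∈ sphere (0 : ℂ) 1) (hab : a ≠ b) (h : dist a x = dist b x) :
    ∃ ξ ε β : ℝ, (ε = 1 ∨ ε = -1) ∧ 0 < β ∧ β ≤ π ∧ x = Complex.exp (ξ * Complex.I) ∧
      b = Complex.exp ((ξ + ε * β : ℝ) * Complex.I) ∧
      a = Complex.exp ((ξ + ε * -β : ℝ) * Complex.I) := by
  rw [mem_sphere_zero_iff_norm] at ha hb hx
  have hx0 : x ≠ 0 := by rintro rfl; simp at hx
  have hu : ‖a / x‖ = 1 := by rw [norm_div, ha, hx, div_one]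
  have hv : ‖b / x‖ = 1 := by rw [norm_div, hb, hx, div_one]
  have hsub : ∀ c : ℂ, ‖c / x - 1‖ = dist c x := by
    intro c
    rw [div_sub_one hx0, norm_div, hx, div_one, dist_eq_norm]
  have hconj : a / x = (starRingEnd ℂ) (b / x) := by
    rcases eq_or_eq_conj_of_norm_sub_one_eq hu hv (by rw [hsub, hsub, h]) with h1 | h1
    · exact absurd ((div_left_inj' hx0).1 h1) hab
    · exact h1
  have hexp : ∀ z : ℂ, ‖z‖ = 1 → Complex.exp (z.arg * Complex.I) = z := by
    intro z hz
    have := Complex.norm_mul_exp_arg_mul_I z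
    rwa [hz, Complex.ofReal_one, one_mul] at this
  set η := (b / x).arg with hη
  have hb' : b = Complex.exp ((x.arg + η : ℝ) * Complex.I) := by
    rw [Complex.ofReal_add, add_mul, Complex.exp_add, hexp x hx, hexp _ hv]
    field_simp
  have ha' : a = Complex.exp ((x.arg - η : ℝ) * Complex.I) := by
    have h1 : Complex.exp (-(η : ℂ) * Complex.I) = a / x := by
      rw [hconj, ← hexp _ hv, ← Complex.exp_conj]
      simp [hη]
    rw [Complex.ofReal_sub, sub_eq_add_neg, add_mul, Complex.exp_add, hexp x hx, h1]
    field_simp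
  have hη0 : η ≠ 0 := by
    intro h0
    rw [h0, add_zero] at hb'
    rw [h0, sub_zero] at ha'
    exact hab (ha'.trans hb'.symm)
  have hηπ : |η| ≤ π := Complex.abs_arg_le_pi _
  rcases lt_or_gt_of_ne hη0 with hneg | hpos
  · refine ⟨x.arg, -1, |η|, Or.inr rfl, abs_pos.2 hη0, hηπ, (hexp x hx).symm, ?_, ?_⟩
    · rw [hb', abs_of_neg hneg]; congr 3; ring
    · rw [ha', abs_of_neg hneg]; congr 3; ring
  · refine ⟨x.arg, 1, |η|, Or.inl rfl, abs_pos.2 hη0, hηπ, (hexp x hx).symm, ?_, ?_⟩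
    · rw [hb', abs_of_pos hpos]; congr 3; ring
    · rw [ha', abs_of_pos hpos]; congr 3; ring

lemma one_le_dist_exp_of_cos_nonpos {ξ θ : ℝ} (h : cos θ ≤ 0) :
    1 ≤ dist (Complex.exp ((ξ + θ : ℝ) * Complex.I)) (Complex.exp (ξ * Complex.I)) := by
  have h1 : dist (Complex.exp ((ξ + θ : ℝ) * Complex.I)) (Complex.exp (ξ * Complex.I)) =
      ‖Complex.exp (θ * Complex.I) - 1‖ := by
    rw [dist_eq_norm, Complex.ofReal_add, add_mul, Complex.exp_add, ← mul_sub_one, norm_mul,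
      Complex.norm_exp_ofReal_mul_I, one_mul]
  rw [h1]
  have h2 := Complex.abs_re_le_norm (Complex.exp (θ * Complex.I) - 1)
  rw [Complex.sub_re, Complex.exp_ofReal_mul_I_re, Complex.one_re,
    abs_of_nonpos (by linarith)] at h2
  linarith

lemma exists_pos_forall_le_dist_image {X Y : Type*} [MetricSpace X] [MetricSpace Y] {f : X → Y}
    {S : Set X} (hS : IsCompact S) (hfc : ContinuousOn f S) (hfi : InjOn f S) {d : ℝ}
    (hd : 0 < d) :
    ∃ m : ℝ, 0 < m ∧ ∀ a ∈ S, ∀ b ∈ S, d ≤ dist a b → m ≤ dist (f a) (f b) := by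
  set T : Set (X × X) := S ×ˢ S ∩ {p | d ≤ dist p.1 p.2} with hT
  have hTc : IsCompact T :=
    (hS.prod hS).inter_right (isClosed_le continuous_const continuous_dist)
  rcases T.eq_empty_or_nonempty with he | hne
  · refine ⟨1, one_pos, fun a ha b hb hab => ?_⟩
    have : (a, b) ∈ T := ⟨⟨ha, hb⟩, hab⟩
    simp [he] at this
  · have hc : ContinuousOn (fun p : X × X => dist (f p.1) (f p.2)) T :=
      continuous_dist.comp_continuousOn
        ((hfc.comp continuousOn_fst fun p (hp : p ∈ T) => hp.1.1).prodMk
          (hfc.comp continuousOn_snd fun p (hp : p ∈ T) => hp.1.2))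
    obtain ⟨p, hp, hmin⟩ := hTc.exists_isMinOn hne hc
    refine ⟨dist (f p.1) (f p.2), dist_pos.2 fun h => ?_, fun a ha b hb hab =>
      hmin (⟨⟨ha, hb⟩, hab⟩ : (a, b) ∈ T)⟩
    have h1 := hfi hp.1.1 hp.1.2 h
    have h2 : d ≤ dist p.1 p.2 := hp.2
    rw [h1, dist_self] at h2
    linarith

lemma range_comp_exp_eq_of_isTQuasidisk {t : ℝ} {Γ Ω : Set ℂ} {f : ℂ → ℂ}
    (hΩ : IsTQuasidisk t Γ Ω)
    (hfc : ContinuousOn f (closedBall (0 : ℂ) 1)) (hfi : InjOn f (closedBall (0 : ℂ) 1))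
    (hfΩ : f '' ball (0 : ℂ) 1 = Ω) :
    range (fun θ : ℝ => f (Complex.exp (θ * Complex.I))) = Γ := by
  obtain ⟨⟨p, hp, rfl⟩, -, -, x, -, rfl⟩ := hΩ
  refine hp.range_eq_of_subset (isJordanParam_comp_exp (hfc.mono sphere_subset_closedBall)
    (hfi.mono sphere_subset_closedBall)) ?_
  rintro _ ⟨θ, rfl⟩
  have hs := exp_ofReal_mul_I_mem_sphere θ
  set z := Complex.exp (θ * Complex.I)
  have hz : z ∈ closedBall (0 : ℂ) 1 := sphere_subset_closedBall hs
  refine mem_of_mem_closure_of_notMem_connectedComponentIn (x := x) ?_ ?_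
  · rw [← hfΩ]
    have hcl : closure (ball (0 : ℂ) 1) = closedBall 0 1 := closure_ball _ one_ne_zero
    exact (hcl ▸ hfc).image_closure (mem_image_of_mem f (hcl ▸ hz))
  · rw [← hfΩ]
    rintro ⟨y, hy, hyz⟩
    have := hfi (ball_subset_closedBall hy) hz hyz
    rw [this, mem_ball] at hy
    rw [mem_sphere] at hs
    linarith

/-- Let `Ω` be a `t`-quasidisk and `f` a conformal map of `𝔻` onto `Ω` with induced
boundary values `f : 𝕋 → ∂Ω`.  Then there is a constant `M > 0` such that for all
`a, b, x ∈ 𝕋` with `|a−x| = |b−x|` one has `|f(a) − f(x)|^(1/t) ≤ M·|f(b) − f(x)|^t`.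
(For `t = 1` this is Ahlfors' `M`-condition.) -/
theorem stmt16 (t : ℝ) (ht : 0 < t) (ht1 : t ≤ 1) (Γ Ω : Set ℂ) (f : ℂ → ℂ)
    (hΩ : IsTQuasidisk t Γ Ω)
    (hfc : ContinuousOn f (Metric.closedBall (0 : ℂ) 1))
    (hfd : DifferentiableOn ℂ f (Metric.ball (0 : ℂ) 1))
    (hfi : Set.InjOn f (Metric.closedBall (0 : ℂ) 1))
    (hfΩ : f '' Metric.ball (0 : ℂ) 1 = Ω) :
    ∃ M : ℝ, 0 < M ∧
      ∀ a ∈ Metric.sphere (0 : ℂ) 1, ∀ b ∈ Metric.sphere (0 : ℂ) 1,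
        ∀ x ∈ Metric.sphere (0 : ℂ) 1, dist a x = dist b x →
          dist (f a) (f x) ^ (1 / t) ≤ M * dist (f b) (f x) ^ t := by
  have hrange := range_comp_exp_eq_of_isTQuasidisk hΩ hfc hfi hfΩ
  obtain ⟨-, ⟨C, hC1, hC⟩, -⟩ := hΩ
  have hC0 : 0 < C := by linarith
  have hsc : sphere (0 : ℂ) 1 ⊆ closedBall 0 1 := sphere_subset_closedBall
  have hh := isJordanParam_comp_exp (hfc.mono hsc) (hfi.mono hsc)
  obtain ⟨m, hm0, hm⟩ := exists_pos_forall_le_dist_image (isCompact_sphere (0 : ℂ) 1)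
    (hfc.mono hsc) (hfi.mono hsc) one_pos
  obtain ⟨D, hD1, hD⟩ : ∃ D : ℝ, 1 ≤ D ∧ ∀ a ∈ sphere (0 : ℂ) 1, ∀ b ∈ sphere (0 : ℂ) 1,
      dist (f a) (f b) ≤ D := by
    have hb := ((isCompact_sphere (0 : ℂ) 1).image_of_continuousOn (hfc.mono hsc)).isBounded
    exact ⟨max 1 (diam (f '' sphere 0 1)), le_max_left _ _, fun a ha b hb' =>
      (dist_le_diam_of_mem hb (mem_image_of_mem f ha) (mem_image_of_mem f hb')).trans
        (le_max_right _ _)⟩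
  have hD0 : 0 < D := by linarith
  have ht' : 0 < 1 / t := by positivity
  have htt : t ≤ 1 / t := by rw [le_div_iff₀ ht]; nlinarith
  set κ : ℝ := min 1 (m / D) with hκ
  have hκ0 : 0 < κ := lt_min one_pos (by positivity)
  set M₁ : ℝ := D ^ (1 / t) with hM₁
  set M₂ : ℝ := D ^ (1 / t) / m ^ t with hM₂
  set M₃ : ℝ := C ^ (1 / t) * D with hM₃
  set M₄ : ℝ := (C / κ) ^ (1 / t) * (exp (16 * π ^ 2) * C) with hM₄
  have hM₁0 : 0 < M₁ := by positivity
  have hM₂0 : 0 < M₂ := by positivity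
  have hM₃0 : 0 < M₃ := by positivity
  have hM₄0 : 0 < M₄ := by positivity
  refine ⟨M₁ + M₂ + M₃ + M₄, by positivity, fun a ha b hb x hx hdist => ?_⟩
  set d := dist (f a) (f x) with hd
  set e := dist (f b) (f x) with he
  have hd0 : 0 ≤ d := dist_nonneg
  have he0 : 0 ≤ e := dist_nonneg
  have hdD : d ≤ D := hD a ha x hx
  have heD : e ≤ D := hD b hb x hx
  have het : 0 ≤ e ^ t := rpow_nonneg he0 t
  have hle : ∀ N, N ≤ M₁ + M₂ + M₃ + M₄ → d ^ (1 / t) ≤ N * e ^ t →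
      d ^ (1 / t) ≤ (M₁ + M₂ + M₃ + M₄) * e ^ t := fun N hN h =>
    h.trans (mul_le_mul_of_nonneg_right hN het)
  by_cases hab : a = b
  · refine hle M₁ (by linarith) ?_
    have hed : e = d := by rw [he, hd, hab]
    rw [hed]
    rcases hd0.eq_or_lt with h0 | h0
    · rw [← h0, zero_rpow ht'.ne', zero_rpow ht.ne', mul_zero]
    · calc d ^ (1 / t) = d ^ (1 / t - t) * d ^ t := by rw [← rpow_add h0]; congr 1; ring
        _ ≤ D ^ (1 / t - t) * d ^ t := by gcongr
        _ ≤ D ^ (1 / t) * d ^ t := by gcongr; linarith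
  obtain ⟨ξ, ε, β, hε, hβ0, hβπ, hxe, hbe, hae⟩ := exists_angles_of_dist_eq ha hb hx hab hdist
  have hcosε : ∀ θ, cos (ε * θ) = cos θ := by
    intro θ; rcases hε with rfl | rfl <;> simp
  by_cases hβ : π / 2 < β
  · refine hle M₂ (by linarith) ?_
    have hme : m ≤ e := by
      refine hm b hb x hx ?_
      rw [hbe, hxe]
      apply one_le_dist_exp_of_cos_nonpos
      rw [hcosε]
      exact cos_nonpos_of_pi_div_two_le_of_le hβ.le (by linarith)
    calc d ^ (1 / t) ≤ D ^ (1 / t) := by gcongr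
      _ = M₂ * m ^ t := by rw [hM₂]; field_simp
      _ ≤ M₂ * e ^ t := by gcongr
  rw [not_lt] at hβ
  obtain ⟨hg, hgr⟩ := hh.comp_add_mul ξ hε
  set g : ℝ → ℂ := fun θ => f (Complex.exp ((ξ + ε * θ : ℝ) * Complex.I)) with hgdef
  have hgC : TQuasicircleCond t C (range g) := by rw [hgr, hrange]; exact hC
  have hg0 : g 0 = f x := by simp [hgdef, hxe]
  have hgβ : g β = f b := by rw [hbe]
  have hgβ' : g (-β) = f a := by rw [hae]
  have hgper : ∀ θ, g (θ + 2 * π) = g θ := hg.2.1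
  have he_pos : 0 < e := by
    rw [he, dist_pos, ← hgβ, ← hg0]
    intro h
    have := hg.eq_of_abs_sub_lt h (by rw [sub_zero, abs_of_pos hβ0]; linarith)
    linarith
  have heg : dist (g 0) (g β) = e := by rw [dist_comm, hg0, hgβ]
  rcases hg.dist_le_or_dist_le hgC 0 β with hnear | hfar
  · refine hle M₄ (by linarith) ?_
    rw [heg] at hnear
    have hfar : ∀ v ∈ Icc β (2 * β), (κ * d / C) ^ (1 / t) ≤ dist (g (-v)) (f x) := by
      intro v hv
      set E := dist (g (-v)) (f x) with hE
      have hvE : dist (g (-v)) (g 0) = E := by rw [hg0]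
      have hkey : κ * d ≤ C * E ^ t := by
        rcases hg.dist_le_or_dist_le hgC (-v) 0 with h | h
        · have h1 := h (-β) ⟨by linarith [hv.1], by linarith⟩ 0 ⟨by linarith [hv.1], le_rfl⟩
          rw [hvE, hgβ', hg0] at h1
          calc κ * d ≤ 1 * d := by gcongr; exact min_le_left _ _
            _ = d := one_mul d
            _ ≤ _ := h1
        · have h1 := h π ⟨pi_pos.le, by linarith [hv.2]⟩ 0 ⟨le_rfl, by linarith [hv.2]⟩
          rw [hvE] at h1
          have h2 : m ≤ dist (g π) (g 0) := by
            rw [hg0]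
            refine hm _ (exp_ofReal_mul_I_mem_sphere _) x hx ?_
            rw [hxe]
            apply one_le_dist_exp_of_cos_nonpos
            rw [hcosε, cos_pi]
            norm_num
          calc κ * d ≤ m / D * D := by gcongr; exact min_le_right _ _
            _ = m := by field_simp
            _ ≤ _ := h2.trans h1
      have hE0 : 0 ≤ E := dist_nonneg
      calc (κ * d / C) ^ (1 / t) ≤ (E ^ t) ^ (1 / t) := by
            gcongr
            rw [div_le_iff₀ hC0]; linarith
        _ = E := by rw [← rpow_mul hE0, mul_one_div_cancel ht.ne', rpow_one]
    have hcore := le_exp_mul_of_adjacent_arcs hfc hfd hfi (ξ := ξ) (w := f x)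
      (r := C * e ^ t) hε hβ0 hβ (by positivity)
      (fun u hu => by
        have := hnear u hu 0 ⟨le_rfl, hβ0.le⟩
        rwa [hg0] at this) hfar
    calc d ^ (1 / t) = (C / κ) ^ (1 / t) * (κ * d / C) ^ (1 / t) := by
          rw [← mul_rpow (by positivity) (by positivity)]
          congr 1
          field_simp
      _ ≤ (C / κ) ^ (1 / t) * (exp (16 * π ^ 2) * (C * e ^ t)) := by gcongr
      _ = M₄ * e ^ t := by rw [hM₄]; ring
  · refine hle M₃ (by linarith) ?_
    rw [heg] at hfar
    have h1 := hfar (-β + 2 * π) ⟨by linarith, by linarith⟩ (0 + 2 * π)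
      ⟨by linarith, le_rfl⟩
    rw [hgper, hgper, hgβ', hg0] at h1
    calc d ^ (1 / t) ≤ (C * e ^ t) ^ (1 / t) := by gcongr
      _ = C ^ (1 / t) * e := by
        rw [mul_rpow hC0.le het, ← rpow_mul he0, mul_one_div_cancel ht.ne', rpow_one]
      _ = C ^ (1 / t) * (e ^ (1 - t) * e ^ t) := by
        rw [← rpow_add he_pos, sub_add_cancel, rpow_one]
      _ ≤ C ^ (1 / t) * (D ^ (1 : ℝ) * e ^ t) := by
        gcongr
        calc e ^ (1 - t) ≤ D ^ (1 - t) := by gcongr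
          _ ≤ D ^ (1 : ℝ) := by gcongr; linarith
      _ = M₃ * e ^ t := by rw [rpow_one, hM₃]; ring
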